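/- arXiv:1803.09838 — 2 statements merged into one kernel-verified Lean document; each statement's English description precedes it below -/
import Mathlib

section
/- Let Z be a standard normal random variable. For every real t, the characteristic function f(t) = E[e^{i t ln|Z|}] admits the convergent infinite product representation f(t) = exp(it·(ln 2)/2) · (1/(1+it)) · ∏_{j=1}^∞ [ exp((it/2)·ln(1+1/j)) / (1 + it/(2j+1)) ], where the infinite product is the limit of the partial products as the number of factors tends to infinity. -/
open MeasureTheory ProbabilityTheory Real Complex Filter

/-- The integral over `ℝ` of an integrable function of `|x|` is twice its integral over `x > 0`. -/
lemma integral_comp_abs_of_integrable {f : ℝ → ℂ} (hf : Integrable (fun x : ℝ => f |x|)) :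
    ∫ x : ℝ, f |x| = 2 * ∫ x in Set.Ioi (0 : ℝ), f x := by
  have h_pos : ∫ x in Set.Ioi (0 : ℝ), f |x| = ∫ x in Set.Ioi (0 : ℝ), f x :=
    setIntegral_congr_fun measurableSet_Ioi fun x hx => by
      simp only [abs_of_pos (Set.mem_Ioi.mp hx)]
  have h_neg : ∫ x in Set.Iic (0 : ℝ), f |x| = ∫ x in Set.Ioi (0 : ℝ), f |x| := by
    simpa using integral_comp_neg_Iic 0 fun x : ℝ => f |x|
  rw [← intervalIntegral.integral_Iic_add_Ioi hf.integrableOn hf.integrableOn (b := 0),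
    h_neg, h_pos, two_mul]

/-- The Mellin transform of `x ↦ exp (-x² / 2)`. -/
lemma mellin_exp_neg_sq_div_two {s : ℂ} (hs : 0 < s.re) :
    mellin (fun x : ℝ => Complex.exp (-((1 / 2 : ℝ) * (x ^ (2 : ℝ) : ℝ)))) s =
      2⁻¹ * ((2 : ℂ) ^ (s / 2) * Complex.Gamma (s / 2)) := by
  have h_re : 0 < (s / 2).re := by
    rw [show s / 2 = s / (2 : ℝ) by norm_num, Complex.div_ofReal_re]
    positivity
  rw [mellin_comp_rpow (fun x : ℝ => Complex.exp (-((1 / 2 : ℝ) * (x : ℂ)))) s 2]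
  have h := Complex.integral_cpow_mul_exp_neg_mul_Ioi h_re (r := 1 / 2) (by norm_num)
  simp only [mellin, smul_eq_mul, Complex.ofReal_ofNat]
  rw [h]
  simp

lemma integral_gaussianReal_exp_log_abs (t : ℝ) :
    ∫ x, Complex.exp (Complex.I * t * Real.log |x|) ∂(gaussianReal 0 1) =
      Complex.exp (Complex.I * t * (Real.log 2 / 2)) *
        (Complex.Gamma (1 / 2 + Complex.I * t / 2) / Complex.Gamma (1 / 2)) := by
  let f : ℝ → ℂ := fun x =>
    (gaussianPDFReal 0 1 x : ℂ) * Complex.exp (Complex.I * t * Real.log x)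
  have hf_abs : ∀ x : ℝ, f |x| = gaussianPDFReal 0 1 x •
      Complex.exp (Complex.I * t * Real.log |x|) := fun x => by
    simp [f, gaussianPDFReal, -Complex.ofReal_pow]
  have hf_int : Integrable fun x : ℝ => f |x| := by
    refine (integrable_gaussianPDFReal 0 1).mono' ?_ (Eventually.of_forall fun x => ?_)
    · simp only [hf_abs]
      have := measurable_gaussianPDFReal 0 1
      exact Measurable.aestronglyMeasurable (by fun_prop)
    · rw [hf_abs, norm_smul, Complex.norm_exp, Real.norm_of_nonneg (gaussianPDFReal_nonneg _ _ _)]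
      simp
  have h_Ioi : ∫ x in Set.Ioi (0 : ℝ), f x = ((√(2 * π))⁻¹ : ℝ) *
      mellin (fun x : ℝ => Complex.exp (-((1 / 2 : ℝ) * (x ^ (2 : ℝ) : ℝ))))
        (1 + Complex.I * t) := by
    rw [mellin, ← integral_const_mul]
    refine setIntegral_congr_fun measurableSet_Ioi fun x hx => ?_
    have hx0 : (x : ℂ) ≠ 0 := by exact_mod_cast (Set.mem_Ioi.mp hx).ne'
    simp only [f, gaussianPDFReal, smul_eq_mul, add_sub_cancel_left, NNReal.coe_one, mul_one,
      sub_zero, Complex.cpow_def_of_ne_zero hx0, ← Complex.ofReal_log (Set.mem_Ioi.mp hx).le,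
      Real.rpow_two]
    push_cast
    rw [mul_assoc, mul_comm (Complex.exp _)]
    ring_nf
  rw [integral_gaussianReal_eq_integral_smul one_ne_zero]
  simp only [← hf_abs]
  rw [integral_comp_abs_of_integrable hf_int, h_Ioi, mellin_exp_neg_sq_div_two (by simp),
    Complex.Gamma_one_half_eq]
  have h_sqrt : ((√(2 * π) : ℝ) : ℂ) = (2 : ℂ) ^ (1 / 2 : ℂ) * (π : ℂ) ^ (1 / 2 : ℂ) := by
    rw [Real.sqrt_mul (by norm_num), Complex.ofReal_mul, Real.sqrt_eq_rpow, Real.sqrt_eq_rpow,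
      Complex.ofReal_cpow (by norm_num), Complex.ofReal_cpow pi_pos.le]
    norm_num
  have h_two : (2 : ℂ) ^ ((1 + Complex.I * t) / 2) = (2 : ℂ) ^ (1 / 2 : ℂ) *
      Complex.exp (Complex.I * t * (Real.log 2 / 2)) := by
    rw [add_div, Complex.cpow_add _ _ two_ne_zero,
      Complex.cpow_def_of_ne_zero two_ne_zero (Complex.I * t / 2), Complex.ofReal_log (by norm_num)]
    push_cast
    ring_nf
  have h2 : (2 : ℂ) ^ (1 / 2 : ℂ) ≠ 0 := by simp [Complex.cpow_eq_zero_iff]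
  have hpi : (π : ℂ) ^ (1 / 2 : ℂ) ≠ 0 := by simp [Complex.cpow_eq_zero_iff, pi_ne_zero]
  rw [h_two, Complex.ofReal_inv, h_sqrt, add_div]
  field_simp

lemma prod_exp_log_div_eq (a : ℂ) (ha : ∀ j : ℕ, 1 / 2 + a + j ≠ 0) (n : ℕ) :
    ∏ j ∈ Finset.Icc 1 n,
        Complex.exp (a * Real.log (1 + 1 / (j : ℝ))) / (1 + 2 * a / (2 * (j : ℂ) + 1)) =
      Complex.exp (a * Real.log (n + 1)) * (1 + 2 * a) *
        ((∏ j ∈ Finset.range (n + 1), (1 / 2 + (j : ℂ))) /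
          ∏ j ∈ Finset.range (n + 1), (1 / 2 + a + (j : ℂ))) := by
  induction n with
  | zero =>
    have h0 : (1 : ℂ) + 2 * a ≠ 0 := by
      have h := ha 0
      contrapose! h
      push_cast
      linear_combination h / 2
    have h1 : (1 : ℂ) / 2 + a ≠ 0 := by simpa using ha 0
    simp only [Finset.Icc_eq_empty_of_lt zero_lt_one, Finset.prod_empty, Nat.cast_zero, zero_add,
      Real.log_one, Complex.ofReal_zero, mul_zero, Complex.exp_zero, Finset.prod_range_one,
      add_zero, one_mul]
    field_simp
  | succ n ih =>
    rw [Finset.prod_Icc_succ_top (by omega), ih, Finset.prod_range_succ _ (n + 1),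
      Finset.prod_range_succ _ (n + 1)]
    have hn : (0 : ℝ) < (n : ℝ) + 1 := by positivity
    have h_log : Real.log (((n + 1 : ℕ) : ℝ) + 1) =
        Real.log (n + 1) + Real.log (1 + 1 / ((n + 1 : ℕ) : ℝ)) := by
      rw [← Real.log_mul (by positivity) (by positivity)]
      congr 1
      push_cast
      field_simp
    have h_odd : 2 * ((n + 1 : ℕ) : ℂ) + 1 ≠ 0 := by norm_cast
    have h_fac : 1 + 2 * a / (2 * ((n + 1 : ℕ) : ℂ) + 1) =
        (1 / 2 + a + ((n + 1 : ℕ) : ℂ)) / (1 / 2 + ((n + 1 : ℕ) : ℂ)) := by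
      rw [show 1 / 2 + ((n + 1 : ℕ) : ℂ) = (2 * ((n + 1 : ℕ) : ℂ) + 1) / 2 by ring]
      field_simp
      ring
    rw [h_fac, h_log, Complex.ofReal_add, mul_add a, Complex.exp_add, div_div_eq_mul_div,
      mul_div_mul_comm]
    ring

lemma tendsto_prod_exp_log_div (a : ℂ) (ha : ∀ j : ℕ, 1 / 2 + a + j ≠ 0) :
    Tendsto (fun n : ℕ => ∏ j ∈ Finset.Icc 1 n,
        Complex.exp (a * Real.log (1 + 1 / (j : ℝ))) / (1 + 2 * a / (2 * (j : ℂ) + 1)))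
      atTop
      (nhds ((1 + 2 * a) * (Complex.Gamma (1 / 2 + a) / Complex.Gamma (1 / 2)))) := by
  have h_half : Complex.Gamma (1 / 2) ≠ 0 := Complex.Gamma_ne_zero_of_re_pos (by norm_num)
  have h_exp : Tendsto (fun n : ℕ => Complex.exp (a * (Real.log (n + 1) - Real.log n : ℝ)))
      atTop (nhds 1) := by
    have h : Tendsto (fun n : ℕ => ((Real.log (n + 1) - Real.log n : ℝ) : ℂ)) atTop (nhds 0) := by
      exact_mod_cast (Complex.continuous_ofReal.tendsto 0).comp
        Real.tendsto_log_nat_add_one_sub_log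
    simpa using (h.const_mul a).cexp
  have h_lim := (h_exp.mul_const (1 + 2 * a)).mul
    ((Complex.GammaSeq_tendsto_Gamma (1 / 2 + a)).div
      (Complex.GammaSeq_tendsto_Gamma (1 / 2)) h_half)
  rw [one_mul] at h_lim
  refine h_lim.congr' ?_
  filter_upwards [eventually_ge_atTop 1] with n hn
  have hn0 : (n : ℂ) ≠ 0 := by exact_mod_cast (by omega : n ≠ 0)
  have h_cpow : (n : ℂ) ^ (1 / 2 + a) =
      (n : ℂ) ^ (1 / 2 : ℂ) * Complex.exp (a * Real.log n) := by
    rw [Complex.cpow_add _ _ hn0, Complex.cpow_def_of_ne_zero hn0 a, Complex.ofReal_log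
      (Nat.cast_nonneg n), Complex.ofReal_natCast, mul_comm a]
  have h_root : (n : ℂ) ^ (1 / 2 : ℂ) ≠ 0 := by simp [Complex.cpow_eq_zero_iff, hn0]
  have h_fact : (n.factorial : ℂ) ≠ 0 := by exact_mod_cast n.factorial_ne_zero
  have h_split : Complex.exp (a * Real.log (n + 1)) =
      Complex.exp (a * (Real.log (n + 1) - Real.log n : ℝ)) * Complex.exp (a * Real.log n) := by
    rw [← Complex.exp_add]
    push_cast
    ring_nf
  have h_prod : ∏ j ∈ Finset.range (n + 1), (1 / 2 + a + (j : ℂ)) ≠ 0 :=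
    Finset.prod_ne_zero_iff.mpr fun j _ => ha j
  simp only [prod_exp_log_div_eq a ha, h_split, Complex.GammaSeq, Pi.div_apply, h_cpow]
  field_simp

/-- The characteristic function of `ln |Z|`, for a standard normal `Z`, admits the
convergent infinite product representation
`f(t) = e^{it (ln 2)/2} · (1/(1+it)) · ∏_{j=1}^∞ e^{(it/2) ln(1+1/j)} / (1 + it/(2j+1))`. -/
theorem charFun_log_abs_gaussian_prod
    {Ω : Type*} [MeasurableSpace Ω] (P : Measure Ω) [IsProbabilityMeasure P]
    (Z : Ω → ℝ) (hZ : Measure.map Z P = gaussianReal 0 1) (t : ℝ) :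
    ∃ L : ℂ,
      Tendsto (fun n : ℕ => ∏ j ∈ Finset.Icc 1 n,
          Complex.exp ((Complex.I * t / 2) * Real.log (1 + 1 / (j : ℝ))) /
            (1 + Complex.I * t / (2 * (j : ℂ) + 1)))
        atTop (nhds L) ∧
      ∫ ω, Complex.exp (Complex.I * t * Real.log |Z ω|) ∂P =
        Complex.exp (Complex.I * t * (Real.log 2 / 2)) * (1 / (1 + Complex.I * t)) * L := by
  have h_re (j : ℕ) : (1 / 2 + Complex.I * t / 2 + (j : ℂ)).re = 1 / 2 + j := by
    simp
  have ha (j : ℕ) : 1 / 2 + Complex.I * t / 2 + (j : ℂ) ≠ 0 := fun h => by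
    have h_zero := h_re j
    rw [h, Complex.zero_re] at h_zero
    linarith [(Nat.cast_nonneg j : (0 : ℝ) ≤ j)]
  have h_one : 1 + Complex.I * t ≠ 0 := fun h => by
    simpa using congrArg Complex.re h
  have h_two : 2 * (Complex.I * t / 2) = Complex.I * t := by ring
  have h_lim := tendsto_prod_exp_log_div (Complex.I * t / 2) ha
  rw [h_two] at h_lim
  refine ⟨_, h_lim, ?_⟩
  have hZ_meas : AEMeasurable Z P :=
    AEMeasurable.of_map_ne_zero (by rw [hZ]; exact IsProbabilityMeasure.ne_zero _)
  rw [← integral_map (f := fun x : ℝ => Complex.exp (Complex.I * t * Real.log |x|)) hZ_meas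
    (Measurable.aestronglyMeasurable (by fun_prop)), hZ, integral_gaussianReal_exp_log_abs]
  field_simp
end

section
/- The series ∑_{j=1}^∞ [ 1/(2j+1) − (1/2)·ln(1+1/j) ] converges and its sum equals γ/2 + ln 2 − 1, where γ is the Euler–Mascheroni constant. -/
open Real Filter

/-- The partial sums expressed through `eulerMascheroniSeq n = H_n - log (n + 1)`. -/
lemma sum_inv_odd_sub_half_log_eq_eulerMascheroniSeq (n : ℕ) :
    ∑ j ∈ Finset.Icc 1 n, (1 / (2 * (j : ℝ) + 1) - (1 / 2) * Real.log (1 + 1 / (j : ℝ))) =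
      eulerMascheroniSeq (2 * n + 1) - eulerMascheroniSeq n / 2 + Real.log 2 - 1 := by
  induction n with
  | zero =>
    norm_num [eulerMascheroniSeq, harmonic_succ]
  | succ n ih =>
    have hn : (0 : ℝ) < n + 1 := by positivity
    have hn' : (0 : ℝ) < n + 2 := by positivity
    have hlog : Real.log (1 + 1 / ((n : ℝ) + 1)) = Real.log (n + 2) - Real.log (n + 1) := by
      rw [← Real.log_div hn'.ne' hn.ne']
      congr 1
      field_simp
      ring
    have hdouble : ∀ x : ℝ, 0 < x → Real.log (2 * x) = Real.log 2 + Real.log x :=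
      fun x hx => Real.log_mul two_ne_zero hx.ne'
    have h₁ : (2 * (n : ℝ) + 1 + 1) = 2 * (n + 1) := by ring
    have h₃ : (n : ℝ) + 1 + 1 = n + 2 := by ring
    rw [Finset.sum_Icc_succ_top (by lia), ih]
    simp only [eulerMascheroniSeq, show 2 * (n + 1) + 1 = 2 * n + 1 + 1 + 1 by ring,
      harmonic_succ (2 * n + 1 + 1), harmonic_succ (2 * n + 1), harmonic_succ n]
    push_cast
    rw [hlog, show 2 * (n : ℝ) + 1 + 1 + 1 + 1 = 2 * (n + 2) by ring, h₁, h₃,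
      hdouble _ hn, hdouble _ hn']
    field_simp
    ring

/-- The series `∑_{j=1}^∞ [1/(2j+1) - (1/2) ln(1+1/j)]` converges and its sum equals
`γ/2 + ln 2 - 1`, where `γ` is the Euler–Mascheroni constant. -/
theorem sum_inv_odd_sub_half_log :
    Tendsto (fun n : ℕ => ∑ j ∈ Finset.Icc 1 n,
        (1 / (2 * (j : ℝ) + 1) - (1 / 2) * Real.log (1 + 1 / (j : ℝ))))
      atTop (nhds (Real.eulerMascheroniConstant / 2 + Real.log 2 - 1)) := by
  simp only [sum_inv_odd_sub_half_log_eq_eulerMascheroniSeq]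
  have hodd : Tendsto (fun n : ℕ => 2 * n + 1) atTop atTop :=
    tendsto_atTop_mono (fun n => by simp only [id]; lia) tendsto_id
  have h := ((tendsto_eulerMascheroniSeq.comp hodd).sub
    (tendsto_eulerMascheroniSeq.div_const 2)).add_const (Real.log 2) |>.sub_const 1
  rwa [sub_half] at h
end
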